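/- There is no 9-vertex forbidden induced subgraph for the class of apex cographs; hence every forbidden induced subgraph for apex cographs has between 5 and 8 vertices. -/

import Mathlib

open SimpleGraph

/-- A cograph is a graph with no induced path on 4 vertices. -/
def IsCograph {V : Type} (G : SimpleGraph V) : Prop :=
  IsEmpty (SimpleGraph.pathGraph 4 ↪g G)

/-- An apex cograph is a graph having a vertex whose deletion yields a cograph
(together with the empty graph). -/
def IsApexCograph {V : Type} (G : SimpleGraph V) : Prop :=
  IsEmpty V ∨ ∃ v : V, IsCograph (G.induce {u : V | u ≠ v})

/-- A forbidden induced subgraph for the class of apex cographs: a graph that is not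
an apex cograph, all of whose proper induced subgraphs are apex cographs. -/
def ForbApexCograph {V : Type} (G : SimpleGraph V) : Prop :=
  ¬ IsApexCograph G ∧ ∀ s : Set V, s ≠ Set.univ → IsApexCograph (G.induce s)

/-- The vertices `x, y, z, w`, in this order, form an induced path. -/
def IsInducedP4 {V : Type} (G : SimpleGraph V) (x y z w : V) : Prop :=
  G.Adj x y ∧ G.Adj y z ∧ G.Adj z w ∧ ¬ G.Adj x z ∧ ¬ G.Adj x w ∧ ¬ G.Adj y w

lemma IsInducedP4.ne {V : Type} {G : SimpleGraph V} {x y z w : V} (h : IsInducedP4 G x y z w) :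
    x ≠ y ∧ x ≠ z ∧ x ≠ w ∧ y ≠ z ∧ y ≠ w ∧ z ≠ w := by
  obtain ⟨h1, h2, h3, h4, h5, h6⟩ := h
  refine ⟨h1.ne, ?_, ?_, h2.ne, ?_, h3.ne⟩
  · rintro rfl; exact h5 h3
  · rintro rfl; exact h4 h3.symm
  · rintro rfl; exact h5 h1

lemma isCograph_iff {V : Type} (G : SimpleGraph V) :
    IsCograph G ↔ ∀ x y z w, ¬ IsInducedP4 G x y z w := by
  constructor
  · rintro ⟨h⟩ x y z w hp
    have hne := hp.ne
    obtain ⟨h1, h2, h3, h4, h5, h6⟩ := hp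
    refine h ⟨⟨![x, y, z, w], ?_⟩, ?_⟩
    · intro i j hij
      fin_cases i <;> fin_cases j <;> simp_all [eq_comm]
    · intro i j
      change G.Adj (![x, y, z, w] i) (![x, y, z, w] j) ↔ _
      fin_cases i <;> fin_cases j <;> simp [pathGraph_adj, G.adj_comm, *]
  · intro h
    refine ⟨fun f => h (f 0) (f 1) (f 2) (f 3) ?_⟩
    simp [IsInducedP4, pathGraph_adj]

/-- The vertex sets of the induced four-vertex paths. -/
def IsP4Set {V : Type} [DecidableEq V] (G : SimpleGraph V) (e : Finset V) : Prop :=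
  ∃ x y z w, IsInducedP4 G x y z w ∧ e = {x, y, z, w}

lemma IsP4Set.card {V : Type} [DecidableEq V] {G : SimpleGraph V} {e : Finset V}
    (h : IsP4Set G e) : e.card = 4 := by
  obtain ⟨x, y, z, w, hp, rfl⟩ := h
  obtain ⟨h1, h2, h3, h4, h5, h6⟩ := hp.ne
  simp [*]

lemma exists_isP4Set_notMem {V : Type} [DecidableEq V] {G : SimpleGraph V}
    (h : ¬ IsApexCograph G) (v : V) : ∃ e, IsP4Set G e ∧ v ∉ e := by
  have h' : ¬ IsCograph (G.induce {u : V | u ≠ v}) := fun hc => h (Or.inr ⟨v, hc⟩)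
  rw [isCograph_iff] at h'
  push Not at h'
  obtain ⟨x, y, z, w, hp⟩ := h'
  refine ⟨{x.1, y.1, z.1, w.1}, ⟨x, y, z, w, hp, rfl⟩, ?_⟩
  have hx := x.2
  have hy := y.2
  have hz := z.2
  have hw := w.2
  simp only [Set.mem_ofPred_eq] at hx hy hz hw
  simp [hx.symm, hy.symm, hz.symm, hw.symm]

lemma ForbApexCograph.exists_forall_mem {V : Type} [DecidableEq V] {G : SimpleGraph V}
    (h : ForbApexCograph G) (w : V) : ∃ v, ∀ e, IsP4Set G e → w ∉ e → v ∈ e := by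
  have hw : ({u | u ≠ w} : Set V) ≠ Set.univ :=
    fun he => (he ▸ Set.mem_univ w : w ∈ {u | u ≠ w}) rfl
  rcases h.2 _ hw with he | ⟨v, hv⟩
  · refine ⟨w, ?_⟩
    rintro e ⟨x, y, z, t, hp, rfl⟩ hwe
    exact (he.false ⟨x, by rintro rfl; simp at hwe⟩).elim
  · refine ⟨v, ?_⟩
    rintro e ⟨x, y, z, t, hp, rfl⟩ hwe
    by_contra hve
    rw [isCograph_iff] at hv
    simp only [Finset.mem_insert, Finset.mem_singleton, not_or] at hwe hve
    refine hv ⟨⟨x, Ne.symm hwe.1⟩, fun h => hve.1 (congrArg Subtype.val h).symm⟩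
      ⟨⟨y, Ne.symm hwe.2.1⟩, fun h => hve.2.1 (congrArg Subtype.val h).symm⟩
      ⟨⟨z, Ne.symm hwe.2.2.1⟩, fun h => hve.2.2.1 (congrArg Subtype.val h).symm⟩
      ⟨⟨t, Ne.symm hwe.2.2.2⟩, fun h => hve.2.2.2 (congrArg Subtype.val h).symm⟩ hp

/-- On at least nine points, a family of four-element sets which has no common point, but of which
the sets avoiding any given point have one, contains three sets meeting pairwise in single
points, not all the same. -/
lemma exists_three_of_nine_le {V : Type} [DecidableEq V] [Fintype V] {P : Finset V → Prop}
    (hP : ∀ e, P e → e.card = 4) (h1 : ∀ v, ∃ e, P e ∧ v ∉ e)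
    (h2 : ∀ w, ∃ v, ∀ e, P e → w ∉ e → v ∈ e) (hV : 9 ≤ Fintype.card V) :
    ∃ e₁ e₂ e₃ a b c, P e₁ ∧ P e₂ ∧ P e₃ ∧ e₁ ∩ e₂ = {b} ∧ e₃ ∩ e₁ = {a} ∧ e₂ ∩ e₃ = {c} ∧
      b ∉ e₃ := by
  classical
  choose g hgP hg using h1
  have hpos : 0 < Fintype.card V := by omega
  obtain ⟨v₀⟩ := Fintype.card_pos_iff.mp hpos
  obtain ⟨⟨e₁, e₂⟩, he, hmin⟩ := Finset.exists_min_image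
    (Finset.univ.filter fun p : Finset V × Finset V => P p.1 ∧ P p.2)
    (fun p => (p.1 ∩ p.2).card) ⟨(g v₀, g v₀), by simp [hgP]⟩
  simp only [Finset.mem_filter, Finset.mem_univ, true_and] at he
  obtain ⟨he₁, he₂⟩ := he
  replace hmin : ∀ e f, P e → P f → (e₁ ∩ e₂).card ≤ (e ∩ f).card := fun e f he hf =>
    hmin (e, f) (by simp [he, hf])
  have hcov : (Finset.univ : Finset V) ⊆
      (e₁ ∪ e₂) ∪ (e₁ ∩ e₂).biUnion (fun x => g x \ (e₁ ∪ e₂)) := by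
    intro w _
    by_contra hw
    obtain ⟨v, hv⟩ := h2 w
    simp only [Finset.mem_union, Finset.mem_biUnion, Finset.mem_sdiff, Finset.mem_inter] at hw
    push Not at hw
    have hv1 := hv e₁ he₁ hw.1.1
    have hv2 := hv e₂ he₂ hw.1.2
    refine hg v (hv _ (hgP v) fun hwg => ?_)
    have := hw.2 v ⟨hv1, hv2⟩ hwg
    tauto
  have hout : ∀ x ∈ e₁ ∩ e₂, (g x \ (e₁ ∪ e₂)).card ≤ 3 - (e₁ ∩ e₂).card := by
    intro x hx
    have k1 := hmin _ _ (hgP x) he₁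
    have k2 := hmin _ _ (hgP x) he₂
    have k3 : ((g x ∩ e₁) ∩ (g x ∩ e₂)).card < (e₁ ∩ e₂).card := by
      refine Finset.card_lt_card ⟨fun y hy => ?_, fun hs => ?_⟩
      · simp only [Finset.mem_inter] at hy ⊢; tauto
      · have := hs hx
        simp only [Finset.mem_inter] at this
        exact hg x this.1.1
    have k4 := Finset.card_union_add_card_inter (g x ∩ e₁) (g x ∩ e₂)
    rw [← Finset.inter_union_distrib_left] at k4
    have k5 := Finset.card_sdiff_add_card_inter (g x) (e₁ ∪ e₂)
    have k6 := hP _ (hgP x)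
    omega
  have hcard := Finset.card_le_card hcov
  rw [Finset.card_univ] at hcard
  have hb := Finset.card_biUnion_le_card_mul _ _ _ hout
  have hu := Finset.card_union_le (e₁ ∪ e₂) ((e₁ ∩ e₂).biUnion (fun x => g x \ (e₁ ∪ e₂)))
  have hu' := Finset.card_union_add_card_inter e₁ e₂
  have hk4 := Finset.card_le_card (Finset.inter_subset_left (s₁ := e₁) (s₂ := e₂))
  rw [hP _ he₁] at hu' hk4
  rw [hP _ he₂] at hu'
  have hk : (e₁ ∩ e₂).card = 1 := by
    generalize (e₁ ∩ e₂).card = k at *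
    interval_cases k <;> omega
  obtain ⟨b, hb'⟩ := Finset.card_eq_one.mp hk
  have hcard3 : ((e₁ ∩ e₂).biUnion (fun x => g x \ (e₁ ∪ e₂))).card = (g b \ (e₁ ∪ e₂)).card := by
    rw [hb', Finset.singleton_biUnion]
  have k1 := hmin _ _ (hgP b) he₁
  have k2 := hmin _ _ he₂ (hgP b)
  have k3 : ((g b ∩ e₁) ∩ (e₂ ∩ g b)).card = 0 := by
    rw [Finset.card_eq_zero, Finset.eq_empty_iff_forall_notMem]
    intro y hy
    simp only [Finset.mem_inter] at hy
    have : y ∈ e₁ ∩ e₂ := by simp [hy]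
    rw [hb', Finset.mem_singleton] at this
    exact hg b (this ▸ hy.1.1)
  have k4 := Finset.card_union_add_card_inter (g b ∩ e₁) (e₂ ∩ g b)
  rw [Finset.inter_comm e₂, ← Finset.inter_union_distrib_left, Finset.inter_comm _ e₂] at k4
  have k5 := Finset.card_sdiff_add_card_inter (g b) (e₁ ∪ e₂)
  have k6 := hP _ (hgP b)
  obtain ⟨a, ha⟩ := Finset.card_eq_one.mp (show (g b ∩ e₁).card = 1 by omega)
  obtain ⟨c, hc⟩ := Finset.card_eq_one.mp (show (e₂ ∩ g b).card = 1 by omega)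
  exact ⟨e₁, e₂, g b, a, b, c, he₁, he₂, hgP b, hb', ha, hc, hg b⟩

/-- Whether six adjacency bits of four vertices describe a path: of the three perfect matchings of
the four vertices, one lies in the graph, one avoids it, and one does neither. -/
def p4Bits (xy xz xw yz yw zw : Bool) : Bool :=
  ((xy && zw) && ((xor xz yw && !(xw || yz)) || (xor xw yz && !(xz || yw)))) ||
  ((xz && yw) && ((xor xy zw && !(xw || yz)) || (xor xw yz && !(xy || zw)))) ||
  ((xw && yz) && ((xor xy zw && !(xz || yw)) || (xor xz yw && !(xy || zw))))

lemma isP4Set_iff {V : Type} [DecidableEq V] {G : SimpleGraph V} [DecidableRel G.Adj]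
    {x y z w : V} (hxy : x ≠ y) (hxz : x ≠ z) (hxw : x ≠ w) (hyz : y ≠ z) (hyw : y ≠ w)
    (hzw : z ≠ w) :
    IsP4Set G {x, y, z, w} ↔ p4Bits (G.Adj x y) (G.Adj x z) (G.Adj x w) (G.Adj y z)
      (G.Adj y w) (G.Adj z w) = true := by
  constructor
  · rintro ⟨s, t, u, v, hp, he⟩
    have hx : x ∈ ({s, t, u, v} : Finset V) := he ▸ by simp
    have hy : y ∈ ({s, t, u, v} : Finset V) := he ▸ by simp
    have hz : z ∈ ({s, t, u, v} : Finset V) := he ▸ by simp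
    have hw : w ∈ ({s, t, u, v} : Finset V) := he ▸ by simp
    clear he
    simp only [Finset.mem_insert, Finset.mem_singleton] at hx hy hz hw
    obtain ⟨h1, h2, h3, h4, h5, h6⟩ := hp
    rcases hx with rfl | rfl | rfl | rfl <;> rcases hy with rfl | rfl | rfl | rfl <;>
      first
      | exact absurd rfl hxy
      | rcases hz with rfl | rfl | rfl | rfl <;>
        first
        | exact absurd rfl hxz
        | exact absurd rfl hyz
        | rcases hw with rfl | rfl | rfl | rfl <;>
          first
          | exact absurd rfl hxw
          | exact absurd rfl hyw
          | exact absurd rfl hzw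
          | try simp only [G.adj_comm y x, G.adj_comm z x, G.adj_comm w x, G.adj_comm z y,
                G.adj_comm w y, G.adj_comm w z] at h1 h2 h3 h4 h5 h6
            simp [p4Bits, *]
  · intro h
    have key : ∀ s t u v : V, IsInducedP4 G s t u v → ({x, y, z, w} : Finset V) = {s, t, u, v} →
      IsP4Set G {x, y, z, w} := fun s t u v hp he => ⟨s, t, u, v, hp, he⟩
    simp only [IsInducedP4] at key
    have c1 := G.adj_comm y x
    have c2 := G.adj_comm z x
    have c3 := G.adj_comm w x
    have c4 := G.adj_comm z y
    have c5 := G.adj_comm w y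
    have c6 := G.adj_comm w z
    by_cases hxy : G.Adj x y <;> by_cases hxz : G.Adj x z <;> by_cases hxw : G.Adj x w <;>
      by_cases hyz : G.Adj y z <;> by_cases hyw : G.Adj y w <;> by_cases hzw : G.Adj z w <;>
      simp only [hxy, hxz, hxw, hyz, hyw, hzw, p4Bits, iff_true, iff_false]
        at h c1 c2 c3 c4 c5 c6 <;>
      first
      | exact absurd h (by decide)
      | refine key x y w z ?_ ?_ <;> [(simp [*]; done); (ext; simp; tauto)]
      | refine key x z w y ?_ ?_ <;> [(simp [*]; done); (ext; simp; tauto)]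
      | refine key x w y z ?_ ?_ <;> [(simp [*]; done); (ext; simp; tauto)]
      | refine key x w z y ?_ ?_ <;> [(simp [*]; done); (ext; simp; tauto)]
      | refine key y x w z ?_ ?_ <;> [(simp [*]; done); (ext; simp; tauto)]
      | refine key y w x z ?_ ?_ <;> [(simp [*]; done); (ext; simp; tauto)]
      | refine key w x y z ?_ ?_ <;> [(simp [*]; done); (ext; simp; tauto)]
      | refine key w x z y ?_ ?_ <;> [(simp [*]; done); (ext; simp; tauto)]
      | refine key w y x z ?_ ?_ <;> [(simp [*]; done); (ext; simp; tauto)]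
      | refine key w y z x ?_ ?_ <;> [(simp [*]; done); (ext; simp; tauto)]
      | refine key w z x y ?_ ?_ <;> [(simp [*]; done); (ext; simp; tauto)]
      | refine key w z y x ?_ ?_ <;> [(simp [*]; done); (ext; simp; tauto)]

/-- Whether at least two of three bits are set. -/
def majority (x y z : Bool) : Bool := (x && y) || (x && z) || (y && z)

set_option synthInstance.maxHeartbeats 400000 in
set_option synthInstance.maxSize 2000 in
/-- The possible adjacency bits for two paths on `{a, b, p, s}` and `{b, c, q, t}`, where adding
`q` or `t` to the first or `p` or `s` to the second creates no further path, and neither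
does `{a, q, t, c}`. -/
lemma majority_of_p4Bits : ∀ ab ap as bp bs ps : Bool, p4Bits ab ap as bp bs ps = true →
    ∀ aq bq pq sq : Bool,
    p4Bits ab ap aq bp bq pq = false → p4Bits ab as aq bs bq sq = false →
    p4Bits ap as aq ps pq sq = false → p4Bits bp bs bq ps pq sq = false →
    ∀ ta tb tp ts : Bool,
    p4Bits ab ap ta bp tb tp = false → p4Bits ab as ta bs tb ts = false →
    p4Bits ap as ta ps tp ts = false → p4Bits bp bs tb ps tp ts = false →
    ∀ qt : Bool, p4Bits bp bq tb pq tp qt = false → p4Bits bs bq tb sq ts qt = false →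
    ∀ bc qc tc : Bool, p4Bits bq tb bc qt qc tc = true →
    ∀ ca : Bool, p4Bits aq ta ca qt qc tc = false →
    ∀ pc : Bool, p4Bits bp bq bc pq pc qc = false → p4Bits bp tb bc tp pc tc = false →
    p4Bits pq tp pc qt qc tc = false →
    ∀ sc : Bool, p4Bits bs bq bc sq sc qc = false → p4Bits bs tb bc ts sc tc = false →
    p4Bits sq ts sc qt qc tc = false →
    majority ab bp bs = majority bc bq tb ∧ majority ab ap as = majority bc qc tc ∧
      (majority ab ap as = majority ab bp bs → ab = bc ∧ ab ≠ ca) := by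
  decide +kernel

/-- Two induced paths `{a, b, p, s}` and `{b, c, q, t}` such that the other ones on these vertices
contain `a`, `b` and `c`. -/
lemma majority_of_isP4Set {V : Type} [DecidableEq V] {G : SimpleGraph V} [DecidableRel G.Adj]
    {a b c p s q t r : V} (hd : [a, b, c, p, s, q, t, r].Nodup)
    (h₁ : IsP4Set G {a, b, p, s}) (h₂ : IsP4Set G {b, q, t, c})
    (h : ∀ f, IsP4Set G f → f = {a, b, p, s} ∨ f = {b, q, t, c} ∨ r ∈ f ∨
      (a ∈ f ∧ b ∈ f ∧ c ∈ f)) :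
    majority (G.Adj a b) (G.Adj b p) (G.Adj b s) = majority (G.Adj b c) (G.Adj b q) (G.Adj b t) ∧
    majority (G.Adj a b) (G.Adj a p) (G.Adj a s) = majority (G.Adj b c) (G.Adj c q) (G.Adj c t) ∧
      (majority (G.Adj a b) (G.Adj a p) (G.Adj a s) =
        majority (G.Adj a b) (G.Adj b p) (G.Adj b s) →
      decide (G.Adj a b) = decide (G.Adj b c) ∧ decide (G.Adj a b) ≠ decide (G.Adj c a)) := by
  have hno : ∀ x y z w : V, [x, y, z, w].Nodup ∧ r ∉ [x, y, z, w] ∧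
      (a ∉ [x, y, z, w] ∨ b ∉ [x, y, z, w] ∨ c ∉ [x, y, z, w]) ∧
      (a ∈ [x, y, z, w] ∨ p ∈ [x, y, z, w] ∨ s ∈ [x, y, z, w]) ∧
      (q ∈ [x, y, z, w] ∨ t ∈ [x, y, z, w]) →
      p4Bits (G.Adj x y) (G.Adj x z) (G.Adj x w) (G.Adj y z) (G.Adj y w) (G.Adj z w) = false := by
    rintro x y z w ⟨hn, hr, habc, hps, hqt⟩
    have hn' := hn
    simp only [List.nodup_cons, List.mem_cons, List.not_mem_nil, not_or, or_false,
      not_false_eq_true, List.nodup_nil, and_true] at hn'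
    rw [← Bool.not_eq_true, ← isP4Set_iff hn'.1.1 hn'.1.2.1 hn'.1.2.2 hn'.2.1.1 hn'.2.1.2 hn'.2.2]
    intro he
    have hmem : ∀ v, v ∈ ({x, y, z, w} : Finset V) ↔ v ∈ [x, y, z, w] := by simp
    rcases h _ he with he | he | he | he
    · simp only [← hmem, he] at hqt
      simp only [Finset.mem_insert, Finset.mem_singleton] at hqt
      grind
    · simp only [← hmem, he] at hps
      simp only [Finset.mem_insert, Finset.mem_singleton] at hps
      grind
    · exact hr ((hmem r).1 he)
    · simp only [hmem] at he
      tauto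
  simp only [List.nodup_cons, List.mem_cons, List.not_mem_nil, not_or, or_false, not_false_eq_true,
    List.nodup_nil, and_true] at hd hno
  rw [isP4Set_iff (by tauto) (by tauto) (by tauto) (by tauto) (by tauto) (by tauto)] at h₁ h₂
  simp only [G.adj_comm c]
  refine majority_of_p4Bits _ _ _ _ _ _ h₁ _ _ _ _ (hno a b p q ?_) (hno a b s q ?_)
    (hno a p s q ?_) (hno b p s q ?_) _ _ _ _ (hno a b p t ?_) (hno a b s t ?_)
    (hno a p s t ?_) (hno b p s t ?_) _ (hno b p q t ?_) (hno b s q t ?_) _ _ _ h₂ _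
    (hno a q t c ?_) _ (hno b p q c ?_) (hno b p t c ?_) (hno p q t c ?_) _
    (hno b s q c ?_) (hno b s t c ?_) (hno s q t c ?_) <;> grind

/-- If three members of a family as in `exists_three_of_nine_le` form a triangle with vertices
`a`, `b`, `c` on nine points, then every other member contains `a`, `b` and `c`. -/
lemma eq_or_mem_of_triangle {V : Type} [DecidableEq V] {P : Finset V → Prop}
    (hP : ∀ e, P e → e.card = 4) (h2 : ∀ w, ∃ v, ∀ e, P e → w ∉ e → v ∈ e)
    {a b c p s q t r u : V} (hd : [a, b, c, p, s, q, t, r, u].Nodup)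
    (h₁ : P {a, b, p, s}) (h₂ : P {b, q, t, c}) (h₃ : P {c, r, u, a}) {f : Finset V} (hf : P f) :
    f = {a, b, p, s} ∨ f = {b, q, t, c} ∨ f = {c, r, u, a} ∨ (a ∈ f ∧ b ∈ f ∧ c ∈ f) := by
  simp only [List.nodup_cons, List.mem_cons, List.not_mem_nil, not_or, or_false, not_false_eq_true,
    List.nodup_nil, and_true] at hd
  have hcommon : ∀ w e e', P e → P e' → w ∉ e → w ∉ e' → w ∉ f →
      ∃ v, v ∈ f ∧ v ∈ e ∧ v ∈ e' := fun w e e' he he' hwe hwe' hwf =>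
    have ⟨v, hv⟩ := h2 w
    ⟨v, hv f hf hwf, hv e he hwe, hv e' he' hwe'⟩
  have hc : ∀ w, w = p ∨ w = s → w ∉ f → c ∈ f := fun w hw hwf => by
    obtain ⟨v, hv⟩ := hcommon w _ _ h₂ h₃ (by simp; grind) (by simp; grind) hwf
    simp only [Finset.mem_insert, Finset.mem_singleton] at hv
    grind
  have ha : ∀ w, w = q ∨ w = t → w ∉ f → a ∈ f := fun w hw hwf => by
    obtain ⟨v, hv⟩ := hcommon w _ _ h₁ h₃ (by simp; grind) (by simp; grind) hwf
    simp only [Finset.mem_insert, Finset.mem_singleton] at hv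
    grind
  have hb : ∀ w, w = r ∨ w = u → w ∉ f → b ∈ f := fun w hw hwf => by
    obtain ⟨v, hv⟩ := hcommon w _ _ h₁ h₂ (by simp; grind) (by simp; grind) hwf
    simp only [Finset.mem_insert, Finset.mem_singleton] at hv
    grind
  have hfour : ∀ x y z w, x ∈ f → y ∈ f → z ∈ f → w ∈ f → [x, y, z, w].Nodup →
      f = {x, y, z, w} := by
    intro x y z w hx hy hz hw hn
    refine (Finset.eq_of_subset_of_card_le (by intro; simp; grind) ?_).symm
    rw [hP f hf, ← List.toFinset_card_of_nodup hn |>.trans (by rfl : [x, y, z, w].length = 4)]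
    simp
  simp only [List.nodup_cons, List.mem_cons, List.not_mem_nil, not_or, or_false,
    not_false_eq_true, List.nodup_nil, and_true] at hfour
  by_cases hcf : c ∈ f
  · by_cases haf : a ∈ f
    · by_cases hbf : b ∈ f
      · exact Or.inr (Or.inr (Or.inr ⟨haf, hbf, hcf⟩))
      · have hr : r ∈ f := by_contra fun hr => hbf (hb r (by simp) hr)
        have hu : u ∈ f := by_contra fun hu => hbf (hb u (by simp) hu)
        exact Or.inr (Or.inr (Or.inl (hfour c r u a hcf hr hu haf (by grind))))
    · have hq : q ∈ f := by_contra fun hq => haf (ha q (by simp) hq)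
      have ht : t ∈ f := by_contra fun ht => haf (ha t (by simp) ht)
      have hbf : b ∈ f := by
        by_contra hbf
        have hr : r ∈ f := by_contra fun hr => hbf (hb r (by simp) hr)
        have he := hfour q t r c hq ht hr hcf (by grind)
        have hu : u ∈ f := by_contra fun hu => hbf (hb u (by simp) hu)
        simp only [he, Finset.mem_insert, Finset.mem_singleton] at hu
        grind
      exact Or.inr (Or.inl (hfour b q t c hbf hq ht hcf (by grind)))
  · have hp : p ∈ f := by_contra fun hp => hcf (hc p (by simp) hp)
    have hs : s ∈ f := by_contra fun hs => hcf (hc s (by simp) hs)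
    have haf : a ∈ f := by
      by_contra haf
      have hq : q ∈ f := by_contra fun hq => haf (ha q (by simp) hq)
      have ht : t ∈ f := by_contra fun ht => haf (ha t (by simp) ht)
      have he := hfour p s q t hp hs hq ht (by grind)
      have hr : r ∉ f := by
        simp only [he, Finset.mem_insert, Finset.mem_singleton]
        grind
      have hbf := hb r (by simp) hr
      simp only [he, Finset.mem_insert, Finset.mem_singleton] at hbf
      grind
    have hbf : b ∈ f := by
      by_contra hbf
      have hr : r ∈ f := by_contra fun hr => hbf (hb r (by simp) hr)
      have hu : u ∈ f := by_contra fun hu => hbf (hb u (by simp) hu)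
      have he := hfour p s r u hp hs hr hu (by grind)
      simp only [he, Finset.mem_insert, Finset.mem_singleton] at haf
      grind
    exact Or.inl (hfour a b p s haf hbf hp hs (by grind))

/-- Three paths forming a triangle on nine vertices cannot be the only ones missing one of the
vertices of the triangle. -/
lemma false_of_triangle {V : Type} [DecidableEq V] {G : SimpleGraph V} [DecidableRel G.Adj]
    {a b c p s q t r u : V} (hd : [a, b, c, p, s, q, t, r, u].Nodup)
    (he₁ : IsP4Set G {a, b, p, s}) (he₂ : IsP4Set G {b, q, t, c}) (he₃ : IsP4Set G {c, r, u, a})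
    (h : ∀ f, IsP4Set G f → f = {a, b, p, s} ∨ f = {b, q, t, c} ∨ f = {c, r, u, a} ∨
      (a ∈ f ∧ b ∈ f ∧ c ∈ f)) : False := by
  have s₁ : ({c, a, r, u} : Finset V) = {c, r, u, a} := by ext; simp; tauto
  have s₂ : ({a, p, s, b} : Finset V) = {a, b, p, s} := by ext; simp; tauto
  have s₃ : ({b, c, q, t} : Finset V) = {b, q, t, c} := by ext; simp; tauto
  obtain ⟨k1, k2, k3⟩ := majority_of_isP4Set (r := r)
    (hd.sublist (by simp) : [a, b, c, p, s, q, t, r].Nodup) he₁ he₂ fun f hf => by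
      rcases h f hf with hf | hf | hf | hf <;> simp [hf]
  obtain ⟨l1, l2, l3⟩ := majority_of_isP4Set (r := p) (s := t) (t := u)
    (show [b, c, a, q, t, r, u, p].Nodup by simp at hd ⊢; grind) (s₃ ▸ he₂) he₃ fun f hf => by
      rcases h f hf with hf | hf | hf | hf <;> simp [hf, s₃]
  obtain ⟨-, m2, -⟩ := majority_of_isP4Set (r := q) (s := u) (t := s)
    (show [c, a, b, r, u, p, s, q].Nodup by simp at hd ⊢; grind) (s₁ ▸ he₃) (s₂ ▸ he₁)
    fun f hf => by
      rcases h f hf with hf | hf | hf | hf <;> simp [hf, s₁, s₂]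
  have hab := k3 (k2.trans (l1.trans m2))
  exact hab.2 (hab.1.trans (l3 (k1.symm.trans (m2.symm.trans l1.symm))).1)

/-- Two elements of a set of four elements, completed to a listing of that set. -/
lemma exists_pair_of_card_eq_four {V : Type} [DecidableEq V] {e : Finset V} {a b : V}
    (he : e.card = 4) (ha : a ∈ e) (hb : b ∈ e) (hab : a ≠ b) :
    ∃ p s, e = {a, b, p, s} ∧ [a, b, p, s].Nodup := by
  have hcard : ((e.erase a).erase b).card = 2 := by
    rw [Finset.card_erase_of_mem (by simp [hb, hab.symm]), Finset.card_erase_of_mem ha, he]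
  obtain ⟨p, s, hps, h⟩ := Finset.card_eq_two.mp hcard
  have hp : p ∈ (e.erase a).erase b := by simp [h]
  have hs : s ∈ (e.erase a).erase b := by simp [h]
  refine ⟨p, s, ?_, ?_⟩
  · rw [← h, Finset.insert_erase (by simp [hb, hab.symm]), Finset.insert_erase ha]
  · simp only [Finset.mem_erase] at hp hs
    simp only [List.nodup_cons, List.mem_cons, List.not_mem_nil]
    grind

lemma ForbApexCograph.card_lt_nine {V : Type} [Finite V] {G : SimpleGraph V}
    (hG : ForbApexCograph G) : Nat.card V < 9 := by
  classical
  have := Fintype.ofFinite V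
  rw [Nat.card_eq_fintype_card]
  by_contra hV
  have hP : ∀ e, IsP4Set G e → e.card = 4 := fun _ he => he.card
  have h2 := hG.exists_forall_mem
  obtain ⟨e₁, e₂, e₃, a, b, c, he₁, he₂, he₃, hb, ha, hc, hbe⟩ :=
    exists_three_of_nine_le hP (exists_isP4Set_notMem hG.1) h2 (by omega)
  have ha' := fun v => Finset.ext_iff.mp ha v
  have hb' := fun v => Finset.ext_iff.mp hb v
  have hc' := fun v => Finset.ext_iff.mp hc v
  simp only [Finset.mem_inter, Finset.mem_singleton] at ha' hb' hc'
  have hab : a ≠ b := by grind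
  have hbc : b ≠ c := by grind
  have hca : c ≠ a := fun h =>
    hab ((hb' a).1 ⟨((ha' a).2 rfl).2, h ▸ ((hc' c).2 rfl).1⟩)
  obtain ⟨p, s, hps, hn₁⟩ := exists_pair_of_card_eq_four (hP _ he₁) ((ha' a).2 rfl).2
    ((hb' b).2 rfl).1 hab
  obtain ⟨q, t, hqt, hn₂⟩ := exists_pair_of_card_eq_four (hP _ he₂) ((hb' b).2 rfl).2
    ((hc' c).2 rfl).1 hbc
  obtain ⟨r, u, hru, hn₃⟩ := exists_pair_of_card_eq_four (hP _ he₃) ((hc' c).2 rfl).2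
    ((ha' a).2 rfl).1 hca
  have e₂_eq : e₂ = {b, q, t, c} := by rw [hqt]; ext; simp; tauto
  have e₃_eq : e₃ = {c, r, u, a} := by rw [hru]; ext; simp; tauto
  have hd : [a, b, c, p, s, q, t, r, u].Nodup := by
    subst hps hqt hru
    simp only [Finset.mem_insert, Finset.mem_singleton] at ha' hb' hc'
    simp only [List.nodup_cons, List.mem_cons, List.not_mem_nil, not_or, or_false,
      not_false_eq_true, List.nodup_nil, and_true] at hn₁ hn₂ hn₃ ⊢
    have h1 := hb' p
    have h2 := hb' s
    have h3 := hc' q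
    have h4 := hc' t
    have h5 := ha' r
    have h6 := ha' u
    clear ha' hb' hc'
    grind
  subst hps e₂_eq e₃_eq
  exact false_of_triangle hd he₁ he₂ he₃ fun f hf =>
    eq_or_mem_of_triangle hP h2 hd he₁ he₂ he₃ hf

/-- There is no 9-vertex forbidden induced subgraph for apex cographs; hence every
forbidden induced subgraph for apex cographs has between 5 and 8 vertices. -/
theorem no_nine_vertex_forb_apex_cograph :
    (∀ (V : Type) [Finite V] (G : SimpleGraph V),
        Nat.card V = 9 → ¬ ForbApexCograph G) ∧
    (∀ (V : Type) [Finite V] (G : SimpleGraph V),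
        ForbApexCograph G → 5 ≤ Nat.card V ∧ Nat.card V ≤ 8) := by
  refine ⟨fun V _ G hV hG => hG.card_lt_nine.ne hV, fun V _ G hG =>
    ⟨?_, Nat.le_of_lt_succ hG.card_lt_nine⟩⟩
  classical
  have := Fintype.ofFinite V
  have hne : Nonempty V := not_isEmpty_iff.mp fun h => hG.1 (Or.inl h)
  obtain ⟨v⟩ := hne
  obtain ⟨e, he, hv⟩ := exists_isP4Set_notMem hG.1 v
  have hlt := Finset.card_lt_univ_of_notMem hv
  rwa [he.card, ← Nat.card_eq_fintype_card] at hlt
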